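/- Let f : ℝ^n → ℝ be continuously differentiable with L-Lipschitz gradient. Let P be a real n×m matrix each of whose columns has Euclidean norm at most 1, let H be a symmetric positive definite m×m matrix with H ⪯ M₂ I_m (M₂ > 0), let c ∈ (0,1), set g = Pᵀ∇f(x) and d = −H g. Then for every step size α with 0 < α ≤ 2(1−c)/(m M₂ L), the Armijo condition f(x + α P d) ≤ f(x) + c α gᵀ d holds. Consequently, a backtracking line search that tries α = βⁱ for i = 0,1,2,… with β ∈ (0,1) terminates with a step size α ≥ min(1, 2β(1−c)/(m M₂ L)). -/

import Mathlib

open Matrix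
open scoped RealInnerProductSpace

/-- The descent lemma along a direction `v`, for a function with Lipschitz gradient. -/
theorem le_add_inner_gradient_add_sq_of_lipschitz {E : Type*} [NormedAddCommGroup E]
    [InnerProductSpace ℝ E] [CompleteSpace E] {f : E → ℝ} {L : ℝ} (hf : Differentiable ℝ f)
    (hlip : ∀ u v : E, ‖gradient f u - gradient f v‖ ≤ L * ‖u - v‖) (x v : E) :
    f (x + v) ≤ f x + ⟪gradient f x, v⟫ + L / 2 * ‖v‖ ^ 2 := by
  have hder : ∀ t : ℝ, HasDerivAt
      (fun t : ℝ => f (x + t • v) - t * ⟪gradient f x, v⟫ - L / 2 * ‖v‖ ^ 2 * t ^ 2)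
      (⟪gradient f (x + t • v), v⟫ - ⟪gradient f x, v⟫ - L * ‖v‖ ^ 2 * t) t := by
    intro t
    have h1 : HasDerivAt (fun t : ℝ => x + t • v) v t := by
      simpa using ((hasDerivAt_id t).smul_const v).const_add x
    have h2 : HasDerivAt (fun t : ℝ => f (x + t • v)) ⟪gradient f (x + t • v), v⟫ t := by
      have h := (hf (x + t • v)).hasGradientAt.hasFDerivAt.comp_hasDerivAt t h1
      rwa [InnerProductSpace.toDual_apply_apply] at h
    have h3 := (hasDerivAt_id t).mul_const ⟪gradient f x, v⟫
    have h4 := ((hasDerivAt_id t).pow 2).const_mul (L / 2 * ‖v‖ ^ 2)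
    refine ((h2.sub h3).sub h4).congr_deriv ?_
    simp
    ring
  have hanti : AntitoneOn
      (fun t : ℝ => f (x + t • v) - t * ⟪gradient f x, v⟫ - L / 2 * ‖v‖ ^ 2 * t ^ 2)
      (Set.Ici 0) := by
    refine antitoneOn_of_deriv_nonpos (convex_Ici 0)
      (fun t _ => (hder t).continuousAt.continuousWithinAt)
      (fun t _ => (hder t).differentiableAt.differentiableWithinAt) fun t ht => ?_
    rw [interior_Ici, Set.mem_Ioi] at ht
    rw [(hder t).deriv, ← inner_sub_left]
    have h1 := real_inner_le_norm (gradient f (x + t • v) - gradient f x) v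
    have h2 := hlip (x + t • v) x
    rw [add_sub_cancel_left, norm_smul, Real.norm_of_nonneg ht.le] at h2
    have h3 := mul_le_mul_of_nonneg_right h2 (norm_nonneg v)
    linarith
  have h := hanti (Set.mem_Ici.2 le_rfl) (Set.mem_Ici.2 zero_le_one) zero_le_one
  simp only [one_smul, zero_smul, add_zero] at h
  linarith

/-- A positive operator `T ≤ M` satisfies `T² ≤ M T`. -/
theorem LinearMap.IsPositive.norm_sq_apply_le {E : Type*} [NormedAddCommGroup E]
    [InnerProductSpace ℝ E] {T : E →ₗ[ℝ] E} (hT : T.IsPositive) {M : ℝ} (hM : 0 < M)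
    (hle : ∀ y, ⟪y, T y⟫ ≤ M * ‖y‖ ^ 2) (y : E) : ‖T y‖ ^ 2 ≤ M * ⟪y, T y⟫ := by
  have h := hT.inner_nonneg_right (M • y - T y)
  have hs : ⟪y, T (T y)⟫ = ‖T y‖ ^ 2 := by
    rw [← hT.isSymmetric, real_inner_self_eq_norm_sq]
  simp only [map_sub, map_smul, inner_sub_left, inner_sub_right, real_inner_smul_left,
    real_inner_smul_right, hs, real_inner_self_eq_norm_sq] at h
  have h2 := hle (T y)
  have h3 : M * ‖T y‖ ^ 2 ≤ M * (M * ⟪y, T y⟫) := by linarith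
  exact le_of_mul_le_mul_left h3 hM

/-- A matrix whose columns have norm at most one has squared operator norm at most the number of
its columns. -/
theorem norm_sq_toEuclideanLin_le_of_norm_col_le_one {n m : ℕ} {P : Matrix (Fin n) (Fin m) ℝ}
    (hcol : ∀ j : Fin m, ‖Matrix.toEuclideanLin P (EuclideanSpace.single j (1 : ℝ))‖ ≤ 1)
    (d : EuclideanSpace ℝ (Fin m)) : ‖Matrix.toEuclideanLin P d‖ ^ 2 ≤ m * ‖d‖ ^ 2 := by
  have hd : d = ∑ j, d j • EuclideanSpace.single j (1 : ℝ) := by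
    simpa using ((EuclideanSpace.basisFun (Fin m) ℝ).sum_repr d).symm
  have h1 : ‖Matrix.toEuclideanLin P d‖ ≤ ∑ j, |d j| := by
    conv_lhs => rw [hd]
    rw [map_sum]
    refine (norm_sum_le _ _).trans (Finset.sum_le_sum fun j _ => ?_)
    rw [map_smul, norm_smul, Real.norm_eq_abs]
    exact mul_le_of_le_one_right (abs_nonneg _) (hcol j)
  calc ‖Matrix.toEuclideanLin P d‖ ^ 2 ≤ (∑ j, |d j|) ^ 2 := by gcongr
    _ ≤ m * ∑ j, |d j| ^ 2 := by
      simpa using sq_sum_le_card_mul_sum_sq (s := Finset.univ) (f := fun j => |d j|)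
    _ = m * ‖d‖ ^ 2 := by simp [EuclideanSpace.norm_sq_eq]

/-- For `f` continuously differentiable with `L`-Lipschitz gradient, `P` with columns of norm at
most 1, `H` symmetric positive definite with `H ⪯ M₂ I`, `c ∈ (0,1)`, `g = Pᵀ∇f(x)`, `d = -Hg`:
every step size `0 < α ≤ 2(1-c)/(m M₂ L)` satisfies the Armijo condition, and backtracking with
ratio `β ∈ (0,1)` terminates with a step size `β^i ≥ min(1, 2β(1-c)/(m M₂ L))`. -/
theorem stmt2 {n m : ℕ} (f : EuclideanSpace ℝ (Fin n) → ℝ)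
    (L : ℝ) (hL : 0 < L) (hf : ContDiff ℝ 1 f)
    (hlip : ∀ u v : EuclideanSpace ℝ (Fin n),
      ‖gradient f u - gradient f v‖ ≤ L * ‖u - v‖)
    (P : Matrix (Fin n) (Fin m) ℝ)
    (hcol : ∀ j : Fin m, ‖Matrix.toEuclideanLin P (EuclideanSpace.single j (1 : ℝ))‖ ≤ 1)
    (H : Matrix (Fin m) (Fin m) ℝ) (hH : H.PosDef)
    (M₂ : ℝ) (hM₂ : 0 < M₂)
    (hHle : (M₂ • (1 : Matrix (Fin m) (Fin m) ℝ) - H).PosSemidef)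
    (c : ℝ) (hc : c ∈ Set.Ioo (0 : ℝ) 1)
    (x : EuclideanSpace ℝ (Fin n))
    (g d : EuclideanSpace ℝ (Fin m))
    (hg : g = Matrix.toEuclideanLin Pᵀ (gradient f x))
    (hd : d = -(Matrix.toEuclideanLin H g))
    (β : ℝ) (hβ : β ∈ Set.Ioo (0 : ℝ) 1) :
    (∀ α : ℝ, 0 < α → α ≤ 2 * (1 - c) / ((m : ℝ) * M₂ * L) →
      f (x + α • Matrix.toEuclideanLin P d) ≤ f x + c * α * ⟪g, d⟫) ∧
    ∃ i : ℕ,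
      f (x + β ^ i • Matrix.toEuclideanLin P d) ≤ f x + c * β ^ i * ⟪g, d⟫ ∧
      min 1 (2 * β * (1 - c) / ((m : ℝ) * M₂ * L)) ≤ β ^ i := by
  have hT : (Matrix.toEuclideanLin H).IsPositive :=
    Matrix.isPositive_toEuclideanLin_iff.2 hH.posSemidef
  have hTle : ∀ y, ⟪y, Matrix.toEuclideanLin H y⟫ ≤ M₂ * ‖y‖ ^ 2 := by
    intro y
    have h := (Matrix.isPositive_toEuclideanLin_iff.2 hHle).inner_nonneg_right y
    rw [map_sub, map_smul, Matrix.toLpLin_one] at h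
    simp only [LinearMap.sub_apply, LinearMap.smul_apply, LinearMap.id_apply, inner_sub_right,
      real_inner_smul_right, real_inner_self_eq_norm_sq] at h
    linarith
  have hadj : ⟪gradient f x, Matrix.toEuclideanLin P d⟫ = ⟪g, d⟫ := by
    rw [hg, ← Matrix.conjTranspose_eq_transpose_of_trivial,
      Matrix.toEuclideanLin_conjTranspose_eq_adjoint, LinearMap.adjoint_inner_left]
  have hgd : ⟪g, d⟫ ≤ 0 := by
    rw [hd, inner_neg_right]
    exact neg_nonpos.2 (hT.inner_nonneg_right g)
  have hPd : ‖Matrix.toEuclideanLin P d‖ ^ 2 ≤ m * (M₂ * -⟪g, d⟫) := by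
    refine (norm_sq_toEuclideanLin_le_of_norm_col_le_one hcol d).trans ?_
    gcongr
    rw [hd, norm_neg, inner_neg_right, neg_neg]
    exact hT.norm_sq_apply_le hM₂ hTle g
  have harmijo : ∀ α : ℝ, 0 < α → m * M₂ * L * α ≤ 2 * (1 - c) →
      f (x + α • Matrix.toEuclideanLin P d) ≤ f x + c * α * ⟪g, d⟫ := by
    intro α hα hle
    have h := le_add_inner_gradient_add_sq_of_lipschitz (hf.differentiable one_ne_zero) hlip x
      (α • Matrix.toEuclideanLin P d)
    rw [real_inner_smul_right, hadj, norm_smul, mul_pow, Real.norm_of_nonneg hα.le] at h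
    have h1 : L / 2 * (α ^ 2 * ‖Matrix.toEuclideanLin P d‖ ^ 2) ≤
        L / 2 * (α ^ 2 * (m * (M₂ * -⟪g, d⟫))) := by gcongr
    have h2 := mul_le_mul_of_nonneg_right hle (mul_nonneg hα.le (neg_nonneg.2 hgd))
    linarith
  obtain rfl | hm := Nat.eq_zero_or_pos m
  · refine ⟨fun α hα hle => ?_, 0, ?_, by simp⟩
    · simp at hle
      linarith
    · simp [Subsingleton.elim d 0]
  have hK : 0 < (m : ℝ) * M₂ * L := by positivity
  have hstep : ∀ α : ℝ, 0 < α → α ≤ 2 * (1 - c) / ((m : ℝ) * M₂ * L) →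
      f (x + α • Matrix.toEuclideanLin P d) ≤ f x + c * α * ⟪g, d⟫ := fun α hα hle =>
    harmijo α hα (by rwa [le_div_iff₀' hK] at hle)
  refine ⟨hstep, ?_⟩
  obtain hone | hone := le_or_gt 1 (2 * (1 - c) / ((m : ℝ) * M₂ * L))
  · exact ⟨0, by simpa using hstep 1 one_pos hone, by simp⟩
  · have hpos : 0 < 2 * (1 - c) / ((m : ℝ) * M₂ * L) :=
      div_pos (by linarith [hc.2]) hK
    obtain ⟨i, hlt, hle⟩ := exists_nat_pow_near_of_lt_one hpos hone.le hβ.1 hβ.2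
    refine ⟨i + 1, hstep _ (pow_pos hβ.1 _) hlt.le, (min_le_right _ _).trans ?_⟩
    calc 2 * β * (1 - c) / ((m : ℝ) * M₂ * L) = β * (2 * (1 - c) / ((m : ℝ) * M₂ * L)) := by ring
      _ ≤ β * β ^ i := mul_le_mul_of_nonneg_left hle hβ.1.le
      _ = β ^ (i + 1) := (pow_succ' β i).symm
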